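/- Rank bound for exchangeable random variables: Let N ≥ 1 and let R_1,…,R_N be an exchangeable finite sequence of real-valued random variables on a probability space. For every j with 1 ≤ j ≤ N, letting R_{(j)} denote the j-th order statistic of the full sample R_1,…,R_N, one has P( R_N ≤ R_{(j)} ) ≥ j/N. -/

import Mathlib

open MeasureTheory

/-- The `k`-th smallest value (zero-indexed) of the finite sample `r : Fin n → ℝ`. -/
noncomputable def orderStat {n : ℕ} (r : Fin n → ℝ) (k : Fin n) : ℝ :=
  r (Tuple.sort r k)

/-- Number of sample points strictly below the `i`-th one. -/
noncomputable def cntBelow {n : ℕ} (r : Fin n → ℝ) (i : Fin n) : ℕ :=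
  ∑ l, if r l < r i then 1 else 0

lemma cntBelow_perm {n : ℕ} (r : Fin n → ℝ) (i : Fin n) (σ : Equiv.Perm (Fin n)) :
    cntBelow (fun l => r (σ l)) i = cntBelow r (σ i) := by
  unfold cntBelow
  exact Equiv.sum_comp σ (fun l => if r l < r (σ i) then 1 else 0)

lemma le_orderStat_iff {n : ℕ} (r : Fin n → ℝ) (i k : Fin n) :
    r i ≤ orderStat r k ↔ cntBelow r i ≤ k := by
  have hm : Monotone (fun a => r (Tuple.sort r a)) := Tuple.monotone_sort r
  have hc : cntBelow r i = (Finset.univ.filter fun a => r (Tuple.sort r a) < r i).card := by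
    unfold cntBelow
    rw [← Equiv.sum_comp (Tuple.sort r), Finset.card_filter]
  rw [hc]
  unfold orderStat
  constructor
  · intro h
    calc _ ≤ (Finset.Iio k).card := by
          apply Finset.card_le_card
          intro a ha
          simp only [Finset.mem_filter, Finset.mem_univ, true_and] at ha
          rw [Finset.mem_Iio]
          by_contra hk
          exact absurd (hm (not_lt.1 hk)) (not_le.2 (lt_of_lt_of_le ha h))
      _ = k := by simp
  · intro h
    by_contra hk
    have : (Finset.Iic k).card ≤
        (Finset.univ.filter fun a => r (Tuple.sort r a) < r i).card := by
      apply Finset.card_le_card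
      intro a ha
      simp only [Finset.mem_filter, Finset.mem_univ, true_and]
      exact lt_of_le_of_lt (hm (Finset.mem_Iic.1 ha)) (not_le.1 hk)
    rw [Fin.card_Iic] at this
    omega

lemma card_le_orderStat {n : ℕ} (r : Fin n → ℝ) (k : Fin n) :
    (k : ℕ) + 1 ≤ (Finset.univ.filter fun i => cntBelow r i ≤ k).card := by
  have hm : Monotone (fun a => r (Tuple.sort r a)) := Tuple.monotone_sort r
  rw [← Fin.card_Iic k, ← Finset.card_map (Tuple.sort r).toEmbedding]
  apply Finset.card_le_card
  intro a ha
  obtain ⟨b, hb, rfl⟩ := Finset.mem_map.1 ha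
  simp only [Finset.mem_filter, Finset.mem_univ, true_and]
  exact (le_orderStat_iff r _ k).1 (hm (Finset.mem_Iic.1 hb))

lemma measurableSet_cnt {n : ℕ} (i : Fin n) (k : ℕ) :
    MeasurableSet {r : Fin n → ℝ | cntBelow r i ≤ k} := by
  have : Measurable fun r : Fin n → ℝ => cntBelow r i := by
    unfold cntBelow
    refine Finset.measurable_sum _ fun l _ => ?_
    exact Measurable.ite (measurableSet_lt (measurable_pi_apply l) (measurable_pi_apply i))
      measurable_const measurable_const
  exact measurableSet_le this measurable_const

/-- **Rank bound for exchangeable random variables.**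
Let `N ≥ 1` and let `R₁, …, R_N` be an exchangeable finite sequence of real-valued random
variables on a probability space.  For every `j` with `1 ≤ j ≤ N`, letting `R₍ⱼ₎` denote the
`j`-th order statistic of the full sample `R₁, …, R_N`, one has `P(R_N ≤ R₍ⱼ₎) ≥ j / N`. -/
theorem rank_bound_exchangeable
    {Ω : Type*} [MeasurableSpace Ω] (P : Measure Ω) [IsProbabilityMeasure P]
    (N : ℕ) (hN : 1 ≤ N)
    (R : Fin N → Ω → ℝ) (hmeas : ∀ i, Measurable (R i))
    (hexch : ∀ σ : Equiv.Perm (Fin N),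
      P.map (fun ω (i : Fin N) => R (σ i) ω) = P.map (fun ω (i : Fin N) => R i ω))
    (j : ℕ) (hj1 : 1 ≤ j) (hjN : j ≤ N) :
    ENNReal.ofReal ((j : ℝ) / N) ≤
      P {ω | R ⟨N - 1, by omega⟩ ω ≤ orderStat (fun i => R i ω) ⟨j - 1, by omega⟩} := by
  set k : Fin N := ⟨j - 1, by omega⟩ with hk
  set e : Fin N := ⟨N - 1, by omega⟩ with he
  have hR : Measurable (fun ω (i : Fin N) => R i ω) := measurable_pi_lambda _ hmeas
  have hset : {ω | R e ω ≤ orderStat (fun i => R i ω) k}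
      = {ω | cntBelow (fun i => R i ω) e ≤ k} := by
    ext ω
    exact le_orderStat_iff (fun i => R i ω) e k
  rw [hset]
  have hmS : ∀ i, MeasurableSet {ω | cntBelow (fun i => R i ω) i ≤ k} := fun i =>
    hR (measurableSet_cnt i k)
  have heq : ∀ i, P {ω | cntBelow (fun i => R i ω) i ≤ k}
      = P {ω | cntBelow (fun i => R i ω) e ≤ k} := by
    intro i
    have h := congrArg (fun m => m {r : Fin N → ℝ | cntBelow r e ≤ k}) (hexch (Equiv.swap e i))
    rw [Measure.map_apply (measurable_pi_lambda _ fun l => hmeas _) (measurableSet_cnt e k),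
      Measure.map_apply hR (measurableSet_cnt e k)] at h
    simp only [Set.preimage_setOf_eq] at h
    rw [← h]
    congr 1
    ext ω
    have := cntBelow_perm (fun i => R i ω) e (Equiv.swap e i)
    simp only [Equiv.swap_apply_left] at this
    simp only [Set.mem_setOf_eq, this]
  have hsum : (j : ENNReal) ≤ ∑ i : Fin N, P {ω | cntBelow (fun i => R i ω) i ≤ k} := by
    calc (j : ENNReal) = ∫⁻ _, (j : ENNReal) ∂P := by simp
      _ ≤ ∫⁻ ω, ∑ i : Fin N,
          Set.indicator {ω | cntBelow (fun i => R i ω) i ≤ k} (fun _ => (1 : ENNReal)) ω ∂P := by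
        apply lintegral_mono
        intro ω
        have h := card_le_orderStat (fun i => R i ω) k
        have hj : (k : ℕ) + 1 = j := by simp only [hk]; omega
        rw [hj] at h
        simp only [Set.indicator_apply, Set.mem_setOf_eq]
        rw [← Finset.sum_filter, Finset.sum_const, nsmul_eq_mul, mul_one]
        exact_mod_cast h
      _ = _ := by
        rw [lintegral_finsetSum _ fun i _ => measurable_const.indicator (hmS i)]
        refine Finset.sum_congr rfl fun i _ => ?_
        rw [lintegral_indicator_const (hmS i), one_mul]
  simp only [heq, Finset.sum_const, Finset.card_univ, Fintype.card_fin, nsmul_eq_mul] at hsum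
  have hN0 : (0 : ℝ) < N := by exact_mod_cast hN
  rw [ENNReal.ofReal_div_of_pos hN0, ENNReal.ofReal_natCast, ENNReal.ofReal_natCast]
  exact ENNReal.div_le_of_le_mul' hsum
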